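/- arXiv:2005.07015 — 6 statements merged into one kernel-verified Lean document; each statement's English description precedes it below -/
import Mathlib

section
/- Let p, q be positive reals and let f : ℝ → ℝ be a nonnegative measurable function. Then ∫₀^∞ ∫₀^∞ (x+y)^(-1/2) · f(xy/(x+y)) · exp(-p·x - q·y) dx dy = (√π·(√p+√q)/(√p·√q)) · ∫₀^∞ f(t) · exp(-(√p+√q)²·t) dt (the corrected form of Prudnikov–Brychkov–Marichev 3.1.3.4). -/
open MeasureTheory Real

lemma aux_gauss : ∫⁻ w : ℝ, ENNReal.ofReal (Real.exp (-w ^ 2)) = ENNReal.ofReal (√π) := by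
  have h := integral_gaussian 1
  have hi := integrable_exp_neg_mul_sq (b := 1) one_pos
  rw [← ofReal_integral_eq_lintegral_ofReal]
  · congr 1
    simpa using h
  · simpa using hi
  · exact Filter.Eventually.of_forall fun x => (Real.exp_pos _).le

lemma aux_sum (a b : ℝ) (ha : 0 < a) (hb : 0 < b) :
    ∫⁻ r in Set.Ioi (0:ℝ), ENNReal.ofReal ((a + b / r ^ 2) *
      Real.exp (-(a ^ 2 * r ^ 2) - b ^ 2 / r ^ 2)) =
    ENNReal.ofReal (√π * Real.exp (-(2 * a * b))) := by
  have himg : (fun r : ℝ => a * r - b / r) '' Set.Ioi 0 = Set.univ := by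
    apply Set.eq_univ_of_forall
    intro w
    have hs : 0 ≤ w ^ 2 + 4 * a * b := by positivity
    have hlt : |w| < √(w ^ 2 + 4 * a * b) := by
      apply Real.lt_sqrt_of_sq_lt
      rw [sq_abs]
      have : 0 < a * b := mul_pos ha hb
      linarith
    have h0 : 0 < w + √(w ^ 2 + 4 * a * b) := by
      have := neg_abs_le w
      linarith
    refine ⟨(w + √(w ^ 2 + 4 * a * b)) / (2 * a), ?_, ?_⟩
    · simp only [Set.mem_Ioi]; positivity
    · have h2 := Real.sq_sqrt hs
      set S := √(w ^ 2 + 4 * a * b)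
      have h0' := h0.ne'
      field_simp
      linear_combination h2
  have hder : ∀ r ∈ Set.Ioi (0:ℝ), HasDerivWithinAt (fun r : ℝ => a * r - b / r)
      (a + b / r ^ 2) (Set.Ioi 0) r := by
    intro r hr
    have hr' : r ≠ 0 := ne_of_gt hr
    have h1 := ((hasDerivAt_id r).const_mul a).sub ((hasDerivAt_inv hr').const_mul b)
    refine (h1.congr_deriv ?_).hasDerivWithinAt
    field_simp
    ring
  have hinj : Set.InjOn (fun r : ℝ => a * r - b / r) (Set.Ioi 0) := by
    intro r hr s hs h
    have hr' : 0 < r := hr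
    have hs' : 0 < s := hs
    have h' : a * r - b / r = a * s - b / s := h
    field_simp at h'
    have h3 : (r - s) * (a * r * s + b) = 0 := by linear_combination h'
    have h4 : 0 < a * r * s + b := by positivity
    rcases mul_eq_zero.1 h3 with h5 | h5
    · linarith
    · linarith
  have key := lintegral_image_eq_lintegral_abs_deriv_mul (s := Set.Ioi (0:ℝ)) measurableSet_Ioi
    hder hinj (fun w => ENNReal.ofReal (Real.exp (-w ^ 2)))
  rw [himg, Measure.restrict_univ, aux_gauss] at key
  rw [mul_comm (√π), ENNReal.ofReal_mul (Real.exp_pos _).le, key,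
    ← lintegral_const_mul' _ _ ENNReal.ofReal_ne_top]
  apply setLIntegral_congr_fun measurableSet_Ioi
  intro r hr
  have hr' : 0 < r := hr
  simp only
  rw [← ENNReal.ofReal_mul (by positivity), ← ENNReal.ofReal_mul (by positivity),
    abs_of_pos (by positivity), mul_left_comm, ← Real.exp_add]
  congr 3
  field_simp
  ring

lemma aux_symm (a b : ℝ) (ha : 0 < a) (hb : 0 < b) :
    ∫⁻ r in Set.Ioi (0:ℝ), ENNReal.ofReal (a * Real.exp (-(a ^ 2 * r ^ 2) - b ^ 2 / r ^ 2)) =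
    ∫⁻ r in Set.Ioi (0:ℝ), ENNReal.ofReal (b / r ^ 2 *
      Real.exp (-(a ^ 2 * r ^ 2) - b ^ 2 / r ^ 2)) := by
  have himg : (fun r : ℝ => b / a * r⁻¹) '' Set.Ioi 0 = Set.Ioi 0 := by
    ext w
    simp only [Set.mem_image, Set.mem_Ioi]
    constructor
    · rintro ⟨r, hr, rfl⟩
      positivity
    · intro hw
      refine ⟨b / (a * w), by positivity, by field_simp⟩
  have hder : ∀ r ∈ Set.Ioi (0:ℝ), HasDerivWithinAt (fun r : ℝ => b / a * r⁻¹)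
      (b / a * -(r ^ 2)⁻¹) (Set.Ioi 0) r := by
    intro r hr
    have hr' : r ≠ 0 := ne_of_gt hr
    exact ((hasDerivAt_inv hr').const_mul _).hasDerivWithinAt
  have hinj : Set.InjOn (fun r : ℝ => b / a * r⁻¹) (Set.Ioi 0) := by
    intro r hr s hs h
    have : b / a ≠ 0 := by positivity
    exact inv_injective (mul_left_cancel₀ this h)
  have key := lintegral_image_eq_lintegral_abs_deriv_mul (s := Set.Ioi (0:ℝ)) measurableSet_Ioi
    hder hinj (fun r => ENNReal.ofReal (a * Real.exp (-(a ^ 2 * r ^ 2) - b ^ 2 / r ^ 2)))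
  rw [himg] at key
  rw [key]
  apply setLIntegral_congr_fun measurableSet_Ioi
  intro r hr
  have hr' : 0 < r := hr
  simp only
  rw [← ENNReal.ofReal_mul (by positivity), mul_neg, abs_neg, abs_of_pos (by positivity),
    ← mul_assoc]
  congr 2
  · field_simp
  · congr 1
    field_simp
    ring

lemma aux_both (a b : ℝ) (ha : 0 < a) (hb : 0 < b) :
    ∫⁻ r in Set.Ioi (0:ℝ), ENNReal.ofReal (2 * (1 + 1 / r ^ 2) *
      Real.exp (-(a ^ 2 * r ^ 2) - b ^ 2 / r ^ 2)) =
    ENNReal.ofReal (√π * (1 / a + 1 / b) * Real.exp (-(2 * a * b))) := by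
  have h1 := aux_sum a b ha hb
  have h2 := aux_symm a b ha hb
  set A := ∫⁻ r in Set.Ioi (0:ℝ),
    ENNReal.ofReal (a * Real.exp (-(a ^ 2 * r ^ 2) - b ^ 2 / r ^ 2)) with hA
  have hs : ∀ c d : ℝ, 0 ≤ c → 0 ≤ d → ∫⁻ r in Set.Ioi (0:ℝ), ENNReal.ofReal ((c * a + d * (b / r ^ 2)) *
      Real.exp (-(a ^ 2 * r ^ 2) - b ^ 2 / r ^ 2)) = ENNReal.ofReal (c + d) * A := by
    intro c d hc hd
    rw [ENNReal.ofReal_add hc hd, add_mul]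
    nth_rewrite 2 [h2]
    rw [hA, ← lintegral_const_mul' _ _ ENNReal.ofReal_ne_top,
      ← lintegral_const_mul' _ _ ENNReal.ofReal_ne_top, ← lintegral_add_left (by fun_prop)]
    congr 1 with r
    rw [← ENNReal.ofReal_mul hc, ← ENNReal.ofReal_mul hd,
      ← ENNReal.ofReal_add (by positivity) (by positivity)]
    congr 1
    ring
  have h3 := hs 1 1 zero_le_one zero_le_one
  simp only [one_mul] at h3
  rw [h1] at h3
  have h4 := hs (2 / a) (2 / b) (by positivity) (by positivity)
  have e : 2 / a + 2 / b = (1 / a + 1 / b) * (1 + 1) := by ring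
  rw [e, ENNReal.ofReal_mul (by positivity), mul_assoc, ← h3,
    ← ENNReal.ofReal_mul (by positivity)] at h4
  have e5 : √π * (1 / a + 1 / b) * Real.exp (-(2 * a * b)) =
      (1 / a + 1 / b) * (√π * Real.exp (-(2 * a * b))) := by ring
  rw [e5, ← h4]
  congr 1 with r
  congr 2
  field_simp

noncomputable def auxK (p q x t : ℝ) : ℝ :=
  x ^ 2 / (x - t) ^ 2 * ((x ^ 2 / (x - t)) ^ (-(1:ℝ)/2) * Real.exp (-p * x - q * (x * t / (x - t))))

lemma aux_inner (p q : ℝ) (f : ℝ → ℝ) (hf0 : ∀ t, 0 ≤ f t) (x : ℝ) (hx : 0 < x) :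
    ∫⁻ y in Set.Ioi (0:ℝ), ENNReal.ofReal ((x + y) ^ (-(1:ℝ)/2) * f (x * y / (x + y)) *
          Real.exp (-p * x - q * y)) =
    ∫⁻ t in Set.Ioo 0 x, ENNReal.ofReal (f t) * ENNReal.ofReal (auxK p q x t) := by
  have himg : (fun t : ℝ => x * t / (x - t)) '' Set.Ioo 0 x = Set.Ioi 0 := by
    ext y
    simp only [Set.mem_image, Set.mem_Ioi, Set.mem_Ioo]
    constructor
    · rintro ⟨t, ⟨h1, h2⟩, rfl⟩
      have : 0 < x - t := by linarith
      positivity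
    · intro hy
      refine ⟨x * y / (x + y), ⟨by positivity, ?_⟩, ?_⟩
      · rw [div_lt_iff₀ (by positivity)]
        nlinarith
      · have : x - x * y / (x + y) = x ^ 2 / (x + y) := by field_simp; ring
        rw [this]
        field_simp
  have hder : ∀ t ∈ Set.Ioo 0 x, HasDerivWithinAt (fun t : ℝ => x * t / (x - t))
      (x ^ 2 / (x - t) ^ 2) (Set.Ioo 0 x) t := by
    intro t ht
    have ht' : x - t ≠ 0 := by have := ht.2; intro h; linarith
    have h1 := ((hasDerivAt_id t).const_mul x).div ((hasDerivAt_id t).const_sub x) ht'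
    refine (h1.congr_deriv ?_).hasDerivWithinAt
    simp only [id]
    congr 1
    ring
  have hinj : Set.InjOn (fun t : ℝ => x * t / (x - t)) (Set.Ioo 0 x) := by
    intro r hr s hs h
    have hr' : x - r ≠ 0 := by have := hr.2; intro h; linarith
    have hs' : x - s ≠ 0 := by have := hs.2; intro h; linarith
    have h' : x * r / (x - r) = x * s / (x - s) := h
    rw [div_eq_div_iff hr' hs'] at h'
    have : x ^ 2 * r = x ^ 2 * s := by linear_combination h'
    exact mul_left_cancel₀ (by positivity) this
  have key := lintegral_image_eq_lintegral_abs_deriv_mul (s := Set.Ioo 0 x) measurableSet_Ioo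
    hder hinj (fun y => ENNReal.ofReal ((x + y) ^ (-(1:ℝ)/2) * f (x * y / (x + y)) *
          Real.exp (-p * x - q * y)))
  rw [himg] at key
  rw [key]
  apply setLIntegral_congr_fun measurableSet_Ioo
  intro t ht
  have ht' : 0 < x - t := by have := ht.2; linarith
  simp only
  have e1 : x + x * t / (x - t) = x ^ 2 / (x - t) := by field_simp; ring
  have e2 : x * (x * t / (x - t)) / (x ^ 2 / (x - t)) = t := by field_simp
  rw [e1, e2, ← ENNReal.ofReal_mul (by positivity), ← ENNReal.ofReal_mul (hf0 t),
    abs_of_pos (by positivity), auxK]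
  congr 1
  ring

lemma aux_outer (p q : ℝ) (hp : 0 < p) (hq : 0 < q) (t : ℝ) (ht : 0 < t) :
    ∫⁻ x in Set.Ioi t, ENNReal.ofReal (auxK p q x t) =
    ENNReal.ofReal (√π * (√p + √q) / (√p * √q)) *
      ENNReal.ofReal (Real.exp (-(√p + √q) ^ 2 * t)) := by
  have himg : (fun r : ℝ => t + t * r ^ 2) '' Set.Ioi 0 = Set.Ioi t := by
    ext y
    simp only [Set.mem_image, Set.mem_Ioi]
    constructor
    · rintro ⟨r, h1, rfl⟩
      have : 0 < t * r ^ 2 := by positivity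
      linarith
    · intro hy
      have h : 0 < (y - t) / t := div_pos (by linarith) ht
      refine ⟨√((y - t) / t), by positivity, ?_⟩
      rw [Real.sq_sqrt h.le]
      field_simp
      ring
  have hder : ∀ r ∈ Set.Ioi (0:ℝ), HasDerivWithinAt (fun r : ℝ => t + t * r ^ 2)
      (2 * t * r) (Set.Ioi 0) r := by
    intro r hr
    have h1 := (((hasDerivAt_id r).pow 2).const_mul t).const_add t
    refine (h1.congr_deriv ?_).hasDerivWithinAt
    simp
    ring
  have hinj : Set.InjOn (fun r : ℝ => t + t * r ^ 2) (Set.Ioi 0) := by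
    intro r hr s hs h
    have hr' : 0 < r := hr
    have hs' : 0 < s := hs
    have h' : t + t * r ^ 2 = t + t * s ^ 2 := h
    have h2 : r ^ 2 = s ^ 2 := mul_left_cancel₀ ht.ne' (add_left_cancel h')
    exact (sq_eq_sq₀ hr'.le hs'.le).1 h2
  have key := lintegral_image_eq_lintegral_abs_deriv_mul (s := Set.Ioi 0) measurableSet_Ioi
    hder hinj (fun x => ENNReal.ofReal (auxK p q x t))
  rw [himg] at key
  have hb := aux_both (√p * √t) (√q * √t) (by positivity) (by positivity)
  have sp := Real.sq_sqrt hp.le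
  have sq' := Real.sq_sqrt hq.le
  have st := Real.sq_sqrt ht.le
  have hp' := Real.sqrt_pos.2 hp
  have hq' := Real.sqrt_pos.2 hq
  have ht' := Real.sqrt_pos.2 ht
  have fin : ENNReal.ofReal (√π * (√p + √q) / (√p * √q)) *
      ENNReal.ofReal (Real.exp (-(√p + √q) ^ 2 * t)) =
      ENNReal.ofReal (√t * Real.exp (-(p + q) * t)) *
      ENNReal.ofReal (√π * (1 / (√p * √t) + 1 / (√q * √t)) *
        Real.exp (-(2 * (√p * √t) * (√q * √t)))) := by
    rw [← ENNReal.ofReal_mul (by positivity), ← ENNReal.ofReal_mul (by positivity)]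
    congr 1
    have : -(√p + √q) ^ 2 * t = -(p + q) * t + -(2 * (√p * √t) * (√q * √t)) := by
      linear_combination (-t) * sp + (-t) * sq' + (2 * √p * √q) * st
    rw [this, Real.exp_add]
    field_simp
    ring
  rw [key, fin, ← hb, ← lintegral_const_mul' _ _ ENNReal.ofReal_ne_top]
  apply setLIntegral_congr_fun measurableSet_Ioi
  intro r hr
  have hr' : 0 < r := hr
  simp only
  rw [← ENNReal.ofReal_mul (by positivity), ← ENNReal.ofReal_mul (by positivity),
    abs_of_pos (by positivity), auxK]
  congr 1
  have e1 : t + t * r ^ 2 - t = t * r ^ 2 := by ring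
  have e2 : ((t + t * r ^ 2) ^ 2 / (t * r ^ 2)) ^ (-(1:ℝ)/2) = r / (√t * (1 + r ^ 2)) := by
    have : (t + t * r ^ 2) ^ 2 / (t * r ^ 2) = (√t * (1 + r ^ 2) / r) ^ 2 := by
      rw [div_pow, mul_pow, st]
      field_simp
    rw [this, neg_div, Real.rpow_neg (by positivity), ← Real.sqrt_eq_rpow,
      Real.sqrt_sq (by positivity), inv_div]
  have e3 : -p * (t + t * r ^ 2) - q * ((t + t * r ^ 2) * t / (t * r ^ 2)) =
      -(p + q) * t + (-((√p * √t) ^ 2 * r ^ 2) - (√q * √t) ^ 2 / r ^ 2) := by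
    rw [mul_pow, mul_pow, sp, sq', st]
    field_simp
    ring
  rw [e1, e2, e3, Real.exp_add]
  have : t = √t ^ 2 := st.symm
  generalize Real.exp (-(p + q) * t) = E1
  generalize Real.exp (-((√p * √t) ^ 2 * r ^ 2) - (√q * √t) ^ 2 / r ^ 2) = E2
  generalize √t = u at *
  subst this
  field_simp
  ring

theorem stmt_0 (p q : ℝ) (hp : 0 < p) (hq : 0 < q) (f : ℝ → ℝ)
    (hf : Measurable f) (hf0 : ∀ t, 0 ≤ f t) :
    (∫⁻ x in Set.Ioi (0:ℝ), ∫⁻ y in Set.Ioi (0:ℝ),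
        ENNReal.ofReal ((x + y) ^ (-(1:ℝ)/2) * f (x * y / (x + y)) *
          Real.exp (-p * x - q * y)))
    = ENNReal.ofReal (Real.sqrt Real.pi * (Real.sqrt p + Real.sqrt q) /
        (Real.sqrt p * Real.sqrt q)) *
      ∫⁻ t in Set.Ioi (0:ℝ),
        ENNReal.ofReal (f t * Real.exp (-(Real.sqrt p + Real.sqrt q) ^ 2 * t)) := by
  have hK : Measurable (fun z : ℝ × ℝ => auxK p q z.1 z.2) := by
    unfold auxK
    fun_prop
  let G : ℝ → ℝ → ENNReal := fun x t =>
    Set.indicator {z : ℝ × ℝ | z.2 < z.1}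
      (fun z => ENNReal.ofReal (f z.2) * ENNReal.ofReal (auxK p q z.1 z.2)) (x, t)
  have hG : Measurable (Function.uncurry G) := by
    refine Measurable.indicator ?_ (measurableSet_lt measurable_snd measurable_fst)
    exact (hf.comp measurable_snd).ennreal_ofReal.mul hK.ennreal_ofReal
  have h1 : (∫⁻ x in Set.Ioi (0:ℝ), ∫⁻ y in Set.Ioi (0:ℝ),
        ENNReal.ofReal ((x + y) ^ (-(1:ℝ)/2) * f (x * y / (x + y)) *
          Real.exp (-p * x - q * y))) =
      ∫⁻ x in Set.Ioi (0:ℝ), ∫⁻ t in Set.Ioi (0:ℝ), G x t := by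
    apply setLIntegral_congr_fun measurableSet_Ioi
    intro x hx
    simp only
    rw [aux_inner p q f hf0 x hx]
    have : ∀ t, G x t = (Set.Iio x).indicator
        (fun t => ENNReal.ofReal (f t) * ENNReal.ofReal (auxK p q x t)) t := by
      intro t
      simp [G, Set.indicator]
    simp_rw [this]
    rw [lintegral_indicator measurableSet_Iio, Measure.restrict_restrict measurableSet_Iio,
      Set.inter_comm, Set.Ioi_inter_Iio]
  rw [h1, lintegral_lintegral_swap hG.aemeasurable,
    ← lintegral_const_mul' _ _ ENNReal.ofReal_ne_top]
  apply setLIntegral_congr_fun measurableSet_Ioi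
  intro t ht
  have ht' : 0 < t := ht
  simp only
  have : ∀ x, G x t = (Set.Ioi t).indicator
      (fun x => ENNReal.ofReal (f t) * ENNReal.ofReal (auxK p q x t)) x := by
    intro x
    simp [G, Set.indicator]
  simp_rw [this]
  rw [lintegral_indicator measurableSet_Ioi, Measure.restrict_restrict measurableSet_Ioi,
    Set.Ioi_inter_Ioi, sup_eq_left.2 ht'.le, lintegral_const_mul' _ _ ENNReal.ofReal_ne_top,
    aux_outer p q hp hq t ht', ENNReal.ofReal_mul (hf0 t), mul_left_comm]
end

section
/- Let p, q be positive reals and let g : ℝ → ℝ be a nonnegative measurable function. Then ∫₀^∞ ∫₀^∞ (y^(1/2)/(x^(1/2)·(x+y))) · g(xy/(x+y)) · exp(-p·x - q·y) dx dy = (√π/√q) · ∫₀^∞ g(t) · t^(-1/2) · exp(-(√p+√q)²·t) dt. -/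
open MeasureTheory Real

lemma cov_scale (c : ℝ) (hc : 0 < c) (F : ℝ → ENNReal) :
    ∫⁻ x in Set.Ioi (0:ℝ), F x = ∫⁻ x in Set.Ioi (0:ℝ), ENNReal.ofReal c * F (c * x) := by
  have himg : (fun u : ℝ => c * u) '' Set.Ioi 0 = Set.Ioi 0 := by
    ext y
    simp only [Set.mem_image, Set.mem_Ioi]
    constructor
    · rintro ⟨u, hu, rfl⟩; positivity
    · intro hy; exact ⟨y / c, by positivity, by field_simp⟩
  have := lintegral_image_eq_lintegral_abs_deriv_mul (s := Set.Ioi (0:ℝ)) (f := fun u => c * u)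
    (f' := fun _ => c) measurableSet_Ioi
    (fun u _ => by simpa using ((hasDerivAt_id u).const_mul c).hasDerivWithinAt)
    (fun u _ v _ h => by simpa [hc.ne'] using h) F
  rw [himg] at this
  rw [this, abs_of_pos hc]

lemma cov_sq (c : ℝ) (hc : 0 < c) (F : ℝ → ENNReal) :
    ∫⁻ x in Set.Ioi (0:ℝ), F x
      = ∫⁻ u in Set.Ioi (0:ℝ), ENNReal.ofReal (c * (2 * u)) * F (c * u ^ 2) := by
  have himg : (fun u : ℝ => c * u ^ 2) '' Set.Ioi 0 = Set.Ioi 0 := by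
    ext y
    simp only [Set.mem_image, Set.mem_Ioi]
    constructor
    · rintro ⟨u, hu, rfl⟩; positivity
    · intro hy
      refine ⟨√(y / c), by positivity, ?_⟩
      rw [Real.sq_sqrt (by positivity)]; field_simp
  have := lintegral_image_eq_lintegral_abs_deriv_mul (s := Set.Ioi (0:ℝ))
    (f := fun u => c * u ^ 2)
    (f' := fun u => c * (2 * u)) measurableSet_Ioi
    (fun u _ => by simpa using (((hasDerivAt_id u).pow 2).const_mul c).hasDerivWithinAt)
    (fun u hu v hv h => by
      have h' : u ^ 2 = v ^ 2 := by simpa [hc.ne'] using h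
      exact (pow_left_inj₀ (le_of_lt hu) (le_of_lt hv) two_ne_zero).1 h') F
  rw [himg] at this
  rw [this]
  refine setLIntegral_congr_fun measurableSet_Ioi fun u hu => ?_
  have hu' : (0:ℝ) < u := hu
  try simp only
  rw [abs_of_pos (by positivity)]

lemma cov_inv (c : ℝ) (hc : 0 < c) (F : ℝ → ENNReal) :
    ∫⁻ x in Set.Ioi (0:ℝ), F x
      = ∫⁻ u in Set.Ioi (0:ℝ), ENNReal.ofReal (c / u ^ 2) * F (c / u) := by
  have himg : (fun u : ℝ => c / u) '' Set.Ioi 0 = Set.Ioi 0 := by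
    ext y
    simp only [Set.mem_image, Set.mem_Ioi]
    constructor
    · rintro ⟨u, hu, rfl⟩; positivity
    · intro hy
      exact ⟨c / y, by positivity, by field_simp⟩
  have := lintegral_image_eq_lintegral_abs_deriv_mul (s := Set.Ioi (0:ℝ))
    (f := fun u => c / u)
    (f' := fun u => -(c / u ^ 2)) measurableSet_Ioi
    (fun u hu => by
      have hu' : u ≠ 0 := ne_of_gt hu
      have := ((hasDerivAt_inv hu').const_mul c).hasDerivWithinAt (s := Set.Ioi 0)
      simpa [div_eq_mul_inv] using this)
    (fun u hu v hv h => by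
      have hu' : (0:ℝ) < u := hu
      have hv' : (0:ℝ) < v := hv
      try simp only at h
      field_simp at h
      linarith) F
  rw [himg] at this
  rw [this]
  refine setLIntegral_congr_fun measurableSet_Ioi fun u hu => ?_
  have hu' : (0:ℝ) < u := hu
  try simp only
  rw [abs_neg, abs_of_pos (by positivity)]

lemma cov_diff (a b : ℝ) (ha : 0 < a) (hb : 0 < b) (F : ℝ → ENNReal) :
    ∫⁻ x, F x
      = ∫⁻ u in Set.Ioi (0:ℝ), ENNReal.ofReal (b + a / u ^ 2) * F (b * u - a / u) := by
  have himg : (fun u : ℝ => b * u - a / u) '' Set.Ioi 0 = Set.univ := by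
    ext y
    simp only [Set.mem_image, Set.mem_Ioi, Set.mem_univ, iff_true]
    have hD : 0 < y ^ 2 + 4 * a * b := by positivity
    have hs : √(y ^ 2 + 4 * a * b) ^ 2 = y ^ 2 + 4 * a * b := Real.sq_sqrt hD.le
    have hlt : |y| < √(y ^ 2 + 4 * a * b) := by
      apply Real.lt_sqrt_of_sq_lt
      rw [sq_abs]; nlinarith [mul_pos ha hb]
    have hpos : 0 < y + √(y ^ 2 + 4 * a * b) := by linarith [neg_abs_le y]
    refine ⟨(y + √(y ^ 2 + 4 * a * b)) / (2 * b), by positivity, ?_⟩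
    generalize √(y ^ 2 + 4 * a * b) = r at *
    field_simp
    nlinarith
  have := lintegral_image_eq_lintegral_abs_deriv_mul (s := Set.Ioi (0:ℝ))
    (f := fun u => b * u - a / u)
    (f' := fun u => b + a / u ^ 2) measurableSet_Ioi
    (fun u hu => by
      have hu' : u ≠ 0 := ne_of_gt hu
      have := (((hasDerivAt_id u).const_mul b).sub
        ((hasDerivAt_inv hu').const_mul a)).hasDerivWithinAt (s := Set.Ioi 0)
      have hd : b * 1 - a * -(u ^ 2)⁻¹ = b + a / u ^ 2 := by
        rw [div_eq_mul_inv]; ring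
      rw [hd] at this
      exact this)
    (fun u hu v hv h => by
      have hu' : (0:ℝ) < u := hu
      have hv' : (0:ℝ) < v := hv
      try simp only at h
      have h2 : (u - v) * (b + a / (u * v)) = 0 := by
        have : (u - v) * (b + a / (u * v)) = (b * u - a / u) - (b * v - a / v) := by
          field_simp; ring
        rw [this, h, sub_self]
      have h3 : b + a / (u * v) ≠ 0 := by positivity
      have := (mul_eq_zero.1 h2).resolve_right h3
      linarith) F
  rw [himg, Measure.restrict_univ] at this
  rw [this]
  refine setLIntegral_congr_fun measurableSet_Ioi fun u hu => ?_
  have hu' : (0:ℝ) < u := hu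
  try simp only
  rw [abs_of_pos (by positivity)]

lemma gauss_diff (a b : ℝ) (ha : 0 < a) (hb : 0 < b) :
    ENNReal.ofReal 2 * ∫⁻ u in Set.Ioi (0:ℝ), ENNReal.ofReal (Real.exp (-(b * u - a / u) ^ 2))
      = ENNReal.ofReal (√π / b) := by
  have hG : ∫⁻ x : ℝ, ENNReal.ofReal (Real.exp (-x ^ 2)) = ENNReal.ofReal √π := by
    rw [← ofReal_integral_eq_lintegral_ofReal]
    · have := integral_gaussian 1
      simp only [neg_mul, one_mul, div_one] at this
      rw [this]
    · simpa using integrable_exp_neg_mul_sq (b := 1) one_pos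
    · exact Filter.Eventually.of_forall fun x => (Real.exp_pos _).le
  rw [cov_diff a b ha hb] at hG
  set I := ∫⁻ u in Set.Ioi (0:ℝ), ENNReal.ofReal (Real.exp (-(b * u - a / u) ^ 2)) with hI
  have h1 : ENNReal.ofReal b * I = ∫⁻ u in Set.Ioi (0:ℝ), ENNReal.ofReal (a / u ^ 2) *
      ENNReal.ofReal (Real.exp (-(b * u - a / u) ^ 2)) := by
    rw [hI, cov_inv (a / b) (by positivity), ← lintegral_const_mul]
    · refine setLIntegral_congr_fun measurableSet_Ioi fun u hu => ?_
      have hu' : (0:ℝ) < u := hu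
      try simp only
      rw [← mul_assoc, ← ENNReal.ofReal_mul hb.le]
      have b1 : b * (a / b / u ^ 2) = a / u ^ 2 := by field_simp
      have b2 : -(b * (a / b / u) - a / (a / b / u)) ^ 2 = -(b * u - a / u) ^ 2 := by
        field_simp
        ring
      rw [b1, b2]
    · fun_prop
  have h2 : ENNReal.ofReal b * I + ENNReal.ofReal b * I = ENNReal.ofReal √π := by
    nth_rw 2 [h1]
    rw [← hG, hI, ← lintegral_const_mul _ (by fun_prop), ← lintegral_add_left (by fun_prop)]
    refine setLIntegral_congr_fun measurableSet_Ioi fun u hu => ?_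
    have hu' : (0:ℝ) < u := hu
    try simp only
    rw [ENNReal.ofReal_add hb.le (by positivity), add_mul]
  have hb' : ENNReal.ofReal b ≠ 0 := by simpa using hb
  rw [ENNReal.ofReal_div_of_pos hb, ENNReal.eq_div_iff hb' ENNReal.ofReal_ne_top, ← h2]
  simp only [ENNReal.ofReal_ofNat]
  ring

theorem stmt_3 (p q : ℝ) (hp : 0 < p) (hq : 0 < q) (g : ℝ → ℝ)
    (hg : Measurable g) (hg0 : ∀ t, 0 ≤ g t) :
    (∫⁻ x in Set.Ioi (0:ℝ), ∫⁻ y in Set.Ioi (0:ℝ),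
        ENNReal.ofReal ((y ^ ((1:ℝ)/2) / (x ^ ((1:ℝ)/2) * (x + y))) * g (x * y / (x + y)) *
          Real.exp (-p * x - q * y)))
    = ENNReal.ofReal (Real.sqrt Real.pi / Real.sqrt q) *
      ∫⁻ t in Set.Ioi (0:ℝ),
        ENNReal.ofReal (g t * t ^ (-(1:ℝ)/2) *
          Real.exp (-(Real.sqrt p + Real.sqrt q) ^ 2 * t)) := by
  have e1 : (∫⁻ x in Set.Ioi (0:ℝ), ∫⁻ y in Set.Ioi (0:ℝ),
        ENNReal.ofReal ((y ^ ((1:ℝ)/2) / (x ^ ((1:ℝ)/2) * (x + y))) * g (x * y / (x + y)) *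
          Real.exp (-p * x - q * y)))
      = ∫⁻ x in Set.Ioi (0:ℝ), ∫⁻ u in Set.Ioi (0:ℝ),
        ENNReal.ofReal (2 * u ^ 2 / (1 + u ^ 2) * g (x * (u ^ 2 / (1 + u ^ 2))) *
          Real.exp (-x * (p + q * u ^ 2))) := by
    refine setLIntegral_congr_fun measurableSet_Ioi fun x hx => ?_
    have hx' : (0:ℝ) < x := hx
    try simp only
    rw [cov_sq x hx']
    refine setLIntegral_congr_fun measurableSet_Ioi fun u hu => ?_
    have hu' : (0:ℝ) < u := hu
    try simp only
    rw [← ENNReal.ofReal_mul (by positivity), ← Real.sqrt_eq_rpow, ← Real.sqrt_eq_rpow,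
      Real.sqrt_mul hx'.le, Real.sqrt_sq hu'.le]
    have hxs : 0 < √x := by positivity
    have a1 : x * (x * u ^ 2) / (x + x * u ^ 2) = x * (u ^ 2 / (1 + u ^ 2)) := by
      field_simp
    have a2 : -p * x - q * (x * u ^ 2) = -x * (p + q * u ^ 2) := by ring
    have a3 : x * (2 * u) * (√x * u / (√x * (x + x * u ^ 2))) = 2 * u ^ 2 / (1 + u ^ 2) := by
      field_simp
    rw [a1, a2, ← a3]
    congr 1
    ring
  have e2 : ∀ u ∈ Set.Ioi (0:ℝ), (∫⁻ x in Set.Ioi (0:ℝ),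
        ENNReal.ofReal (2 * u ^ 2 / (1 + u ^ 2) * g (x * (u ^ 2 / (1 + u ^ 2))) *
          Real.exp (-x * (p + q * u ^ 2))))
      = ∫⁻ t in Set.Ioi (0:ℝ), ENNReal.ofReal (2 * g t * Real.exp (-(√p + √q) ^ 2 * t) *
          Real.exp (-t * (√q * u - √p / u) ^ 2)) := by
    intro u hu
    have hu' : (0:ℝ) < u := hu
    rw [cov_scale ((1 + u ^ 2) / u ^ 2) (by positivity)]
    refine setLIntegral_congr_fun measurableSet_Ioi fun t ht => ?_
    try simp only
    rw [← ENNReal.ofReal_mul (by positivity)]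
    have a1 : (1 + u ^ 2) / u ^ 2 * t * (u ^ 2 / (1 + u ^ 2)) = t := by field_simp
    have a2 : -((1 + u ^ 2) / u ^ 2 * t) * (p + q * u ^ 2)
        = -(√p + √q) ^ 2 * t + -t * (√q * u - √p / u) ^ 2 := by
      have hP := Real.sq_sqrt hp.le
      have hQ := Real.sq_sqrt hq.le
      generalize √p = P at *
      generalize √q = Q at *
      subst hP hQ
      field_simp
      ring
    rw [a1, a2, Real.exp_add]
    congr 1
    field_simp
  rw [e1, lintegral_lintegral_swap (by unfold Function.uncurry; fun_prop),
    setLIntegral_congr_fun measurableSet_Ioi e2,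
    lintegral_lintegral_swap (by unfold Function.uncurry; fun_prop),
    ← lintegral_const_mul _ (by fun_prop)]
  refine setLIntegral_congr_fun measurableSet_Ioi fun t ht => ?_
  have ht' : (0:ℝ) < t := ht
  try simp only
  have hts : 0 < √t := by positivity
  have hP : 0 < √p := by positivity
  have hQ : 0 < √q := by positivity
  have hgt := hg0 t
  have h := gauss_diff (√t * √p) (√t * √q) (by positivity) (by positivity)
  have e3 : (∫⁻ u in Set.Ioi (0:ℝ), ENNReal.ofReal (2 * g t * Real.exp (-(√p + √q) ^ 2 * t) *
          Real.exp (-t * (√q * u - √p / u) ^ 2)))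
      = ENNReal.ofReal (g t * Real.exp (-(√p + √q) ^ 2 * t)) * (ENNReal.ofReal 2 *
        ∫⁻ u in Set.Ioi (0:ℝ),
          ENNReal.ofReal (Real.exp (-(√t * √q * u - √t * √p / u) ^ 2))) := by
    rw [← mul_assoc, ← ENNReal.ofReal_mul (by positivity), ← lintegral_const_mul _ (by fun_prop)]
    refine setLIntegral_congr_fun measurableSet_Ioi fun u hu => ?_
    try simp only
    rw [← ENNReal.ofReal_mul (by positivity)]
    have a1 : -(√t * √q * u - √t * √p / u) ^ 2 = -t * (√q * u - √p / u) ^ 2 := by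
      nth_rw 3 [← Real.sq_sqrt ht'.le]
      ring
    rw [a1]
    congr 1
    ring
  rw [e3, h, ← ENNReal.ofReal_mul (by positivity), ← ENNReal.ofReal_mul (by positivity)]
  have a4 : t ^ (-(1:ℝ)/2) = (√t)⁻¹ := by
    rw [Real.sqrt_eq_rpow, ← Real.rpow_neg ht'.le]
    norm_num
  rw [a4]
  congr 1
  field_simp
end

section
/- Let p, q be positive reals and let g : ℝ → ℝ be a nonnegative measurable function. Then ∫₀^∞ ∫₀^∞ (y^(5/2)/(x^(1/2)·(x+y)²)) · g(xy/(x+y)) · exp(-p·x - q·y) dx dy = (√π/(2·q^(3/2))) · ∫₀^∞ g(t) · t^(-1/2) · (1 + 2·√p·√q·t) · exp(-(√p+√q)²·t) dt. -/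
open MeasureTheory Real

theorem aux_scale (f : ℝ → ENNReal) (c : ℝ) (hc : 0 < c) :
    ∫⁻ y in Set.Ioi (0:ℝ), f y = ∫⁻ s in Set.Ioi (0:ℝ), ENNReal.ofReal c * f (c * s) := by
  have him : (fun s : ℝ => c * s) '' Set.Ioi (0:ℝ) = Set.Ioi 0 := by
    rw [Set.image_mul_left_Ioi hc]; simp
  have h := lintegral_image_eq_lintegral_abs_deriv_mul (s := Set.Ioi (0:ℝ))
    (f := fun s : ℝ => c * s) (f' := fun _ => c) measurableSet_Ioi
    (fun x _ => by simpa using ((hasDerivAt_id x).const_mul c).hasDerivWithinAt)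
    (fun a _ b _ hab => mul_left_cancel₀ hc.ne' hab) f
  rw [him] at h
  rw [h, abs_of_pos hc]

noncomputable def auxG (w : ℝ) : ℝ := ∫ u in (0:ℝ)..w, Real.exp (-u ^ 2)

theorem auxG_deriv (w : ℝ) : HasDerivAt auxG (Real.exp (-w ^ 2)) w := by
  have hc : Continuous (fun u : ℝ => Real.exp (-u ^ 2)) := by fun_prop
  exact intervalIntegral.integral_hasDerivAt_right (hc.intervalIntegrable _ _)
    (hc.stronglyMeasurableAtFilter _ _) hc.continuousAt

theorem auxG_top : Filter.Tendsto auxG Filter.atTop (nhds (√π / 2)) := by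
  have h := intervalIntegral_tendsto_integral_Ioi (μ := volume)
    (f := fun u : ℝ => Real.exp (-1 * u ^ 2)) 0
    (integrable_exp_neg_mul_sq one_pos).integrableOn (Filter.tendsto_id)
  rw [integral_gaussian_Ioi] at h
  simpa [funext_iff, show auxG = fun w => ∫ u in (0:ℝ)..w, Real.exp (-u ^ 2) from rfl] using h

theorem auxG_neg (w : ℝ) : auxG (-w) = -auxG w := by
  unfold auxG
  have h := intervalIntegral.integral_comp_neg (a := 0) (b := w) (fun u : ℝ => Real.exp (-u ^ 2))
  simp only [neg_zero, even_two.neg_pow] at h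
  rw [h, intervalIntegral.integral_symm]

theorem auxG_bot : Filter.Tendsto auxG Filter.atBot (nhds (-(√π / 2))) := by
  have h := (auxG_top.comp Filter.tendsto_neg_atBot_atTop).neg
  refine h.congr (fun x => ?_)
  simp [auxG_neg]

noncomputable def auxH (α β v : ℝ) : ℝ :=
  1 / (2 * β ^ 2) * (1 / (2 * β) + α) * auxG (β * v - α / v)
  + Real.exp (4 * α * β) / (2 * β ^ 2) * (1 / (2 * β) - α) * auxG (β * v + α / v)
  - v * Real.exp (-(β * v - α / v) ^ 2) / (2 * β ^ 2)

theorem auxH_deriv (α β v : ℝ) (hβ : 0 < β) (hv : 0 < v) :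
    HasDerivAt (auxH α β) (v ^ 2 * Real.exp (-(β * v - α / v) ^ 2)) v := by
  have h1 : HasDerivAt (fun v : ℝ => β * v) β v := by
    simpa using (hasDerivAt_id v).const_mul β
  have h2 : HasDerivAt (fun v : ℝ => α / v) (-(α / v ^ 2)) v := by
    have := (hasDerivAt_inv hv.ne').const_mul α
    simpa [div_eq_mul_inv] using this
  have hm := h1.sub h2
  have hpl := h1.add h2
  have hGm := (auxG_deriv (β * v - α / v)).comp v hm
  have hGp := (auxG_deriv (β * v + α / v)).comp v hpl
  have hE := ((hm.pow 2).neg).exp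
  have hvE := (hasDerivAt_id v).mul hE
  have h := ((hGm.const_mul (1 / (2 * β ^ 2) * (1 / (2 * β) + α))).add
    (hGp.const_mul (Real.exp (4 * α * β) / (2 * β ^ 2) * (1 / (2 * β) - α)))).sub
    (hvE.div_const (2 * β ^ 2))
  refine (HasDerivAt.congr_deriv h ?_)
  have he : Real.exp (4 * α * β) * Real.exp (-(β * v + α / v) ^ 2)
      = Real.exp (-(β * v - α / v) ^ 2) := by
    rw [← Real.exp_add]; congr 1; field_simp; ring
  have he' : Real.exp (-(β * v + α / v) ^ 2)
      = Real.exp (-(β * v - α / v) ^ 2) / Real.exp (4 * α * β) := by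
    rw [← he]; field_simp
  rw [he']
  simp only [Pi.sub_apply, Pi.neg_apply, Pi.pow_apply, id, show (2 - 1 : ℕ) = 1 from rfl, pow_one]
  field_simp
  ring

theorem auxH_top (α β : ℝ) (hα : 0 < α) (hβ : 0 < β) :
    Filter.Tendsto (auxH α β) Filter.atTop
      (nhds (1 / (2 * β ^ 2) * (1 / (2 * β) + α) * (√π / 2)
        + Real.exp (4 * α * β) / (2 * β ^ 2) * (1 / (2 * β) - α) * (√π / 2) - 0)) := by
  have h1 : Filter.Tendsto (fun v : ℝ => β * v) Filter.atTop Filter.atTop :=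
    Filter.tendsto_id.const_mul_atTop hβ
  have h2 : Filter.Tendsto (fun v : ℝ => α / v) Filter.atTop (nhds 0) :=
    Filter.tendsto_id.const_div_atTop α
  have hp := h1.atTop_add h2
  have hm := h1.atTop_add h2.neg
  refine ((Filter.Tendsto.const_mul _ (auxG_top.comp ?_)).add
    (Filter.Tendsto.const_mul _ (auxG_top.comp hp))).sub ?_
  · simpa [sub_eq_add_neg] using hm
  · have hz : Filter.Tendsto (fun v : ℝ => (Real.exp (2 * α * β) / (2 * β ^ 4)) / v)
        Filter.atTop (nhds 0) := Filter.tendsto_id.const_div_atTop _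
    refine squeeze_zero' ?_ ?_ hz
    · filter_upwards [Filter.eventually_gt_atTop 0] with v hv
      positivity
    · filter_upwards [Filter.eventually_gt_atTop 0] with v hv
      have e1 : Real.exp (-(β * v - α / v) ^ 2)
          ≤ Real.exp (2 * α * β) * Real.exp (-(β * v) ^ 2) := by
        rw [← Real.exp_add]
        apply Real.exp_le_exp.mpr
        have : (β * v - α / v) ^ 2 = (β * v) ^ 2 - 2 * α * β + (α / v) ^ 2 := by
          field_simp; ring
        nlinarith [sq_nonneg (α / v)]
      have e2 : Real.exp (-(β * v) ^ 2) ≤ 1 / (β * v) ^ 2 := by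
        rw [Real.exp_neg, ← one_div]
        apply one_div_le_one_div_of_le (by positivity)
        linarith [Real.add_one_le_exp ((β * v) ^ 2)]
      calc v * Real.exp (-(β * v - α / v) ^ 2) / (2 * β ^ 2)
          ≤ v * (Real.exp (2 * α * β) * (1 / (β * v) ^ 2)) / (2 * β ^ 2) := by
            gcongr
            exact e1.trans (by gcongr)
        _ = _ := by field_simp

theorem auxH_zero (α β : ℝ) (hα : 0 < α) (hβ : 0 < β) :
    Filter.Tendsto (auxH α β) (nhdsWithin 0 (Set.Ioi 0))
      (nhds (1 / (2 * β ^ 2) * (1 / (2 * β) + α) * (-(√π / 2))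
        + Real.exp (4 * α * β) / (2 * β ^ 2) * (1 / (2 * β) - α) * (√π / 2) - 0)) := by
  have h0 : Filter.Tendsto (fun v : ℝ => v) (nhdsWithin 0 (Set.Ioi 0)) (nhds 0) :=
    Filter.tendsto_id.mono_left nhdsWithin_le_nhds
  have h1 : Filter.Tendsto (fun v : ℝ => β * v) (nhdsWithin 0 (Set.Ioi 0)) (nhds 0) := by
    simpa using h0.const_mul β
  have h2 : Filter.Tendsto (fun v : ℝ => α / v) (nhdsWithin 0 (Set.Ioi 0)) Filter.atTop := by
    simpa [div_eq_mul_inv] using (tendsto_inv_nhdsGT_zero (𝕜 := ℝ)).const_mul_atTop hα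
  have hp := h1.add_atTop h2
  have hm := h1.add_atBot (Filter.tendsto_neg_atTop_atBot.comp h2)
  refine ((Filter.Tendsto.const_mul _ (auxG_bot.comp ?_)).add
    (Filter.Tendsto.const_mul _ (auxG_top.comp hp))).sub ?_
  · simpa [sub_eq_add_neg] using hm
  · have hz : Filter.Tendsto (fun v : ℝ => v / (2 * β ^ 2))
        (nhdsWithin 0 (Set.Ioi 0)) (nhds 0) := by simpa using h0.div_const (2 * β ^ 2)
    refine squeeze_zero' ?_ ?_ hz
    · filter_upwards [self_mem_nhdsWithin] with v hv
      have : 0 < v := hv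
      positivity
    · filter_upwards [self_mem_nhdsWithin] with v hv
      have hv' : 0 < v := hv
      have e1 : Real.exp (-(β * v - α / v) ^ 2) ≤ 1 := by
        apply Real.exp_le_one_iff.mpr
        nlinarith [sq_nonneg (β * v - α / v)]
      gcongr
      nlinarith

/-- The key one-dimensional integral. -/
theorem aux_key (α β : ℝ) (hα : 0 < α) (hβ : 0 < β) :
    ∫⁻ s in Set.Ioi (0:ℝ), ENNReal.ofReal (√s * Real.exp (-(β * √s - α / √s) ^ 2))
      = ENNReal.ofReal (√π / (2 * β ^ 3) * (1 + 2 * α * β)) := by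
  set L := (1 / (2 * β ^ 2) * (1 / (2 * β) + α) * (-(√π / 2))
        + Real.exp (4 * α * β) / (2 * β ^ 2) * (1 / (2 * β) - α) * (√π / 2) - 0) with hL
  set F : ℝ → ℝ := Function.update (fun s => 2 * auxH α β √s) 0 (2 * L) with hF
  have hF0 : F 0 = 2 * L := by simp [hF]
  have hFne : ∀ s, 0 < s → F =ᶠ[nhds s] fun s => 2 * auxH α β √s := by
    intro s hs
    filter_upwards [eventually_ne_nhds hs.ne'] with x hx
    simp [hF, Function.update_of_ne hx]
  have hcont : ContinuousWithinAt F (Set.Ici 0) 0 := by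
    rw [hF, continuousWithinAt_update_same, Set.Ici_sdiff_left]
    refine ((auxH_zero α β hα hβ).comp ?_).const_mul 2
    refine tendsto_nhdsWithin_iff.mpr ⟨?_, ?_⟩
    · have := (Real.continuous_sqrt.tendsto 0).mono_left
        (nhdsWithin_le_nhds (s := Set.Ioi (0:ℝ)))
      simpa using this
    · filter_upwards [self_mem_nhdsWithin] with x hx
      exact Real.sqrt_pos.mpr hx
  have hderiv : ∀ s ∈ Set.Ioi (0:ℝ),
      HasDerivAt F (√s * Real.exp (-(β * √s - α / √s) ^ 2)) s := by
    intro s hs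
    have hs' : 0 < s := hs
    have hq : 0 < √s := Real.sqrt_pos.mpr hs'
    have h := ((auxH_deriv α β √s hβ hq).comp s (Real.hasDerivAt_sqrt hs'.ne')).const_mul 2
    refine (h.congr_of_eventuallyEq (hFne s hs')).congr_deriv ?_
    field_simp
  have hpos : ∀ s ∈ Set.Ioi (0:ℝ), 0 ≤ √s * Real.exp (-(β * √s - α / √s) ^ 2) := by
    intro s _; positivity
  have htop := ((auxH_top α β hα hβ).comp Real.tendsto_sqrt_atTop).const_mul 2
  have htop' : Filter.Tendsto F Filter.atTop _ := htop.congr' (by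
    filter_upwards [Filter.eventually_gt_atTop 0] with s hs
    exact ((hFne s hs).self_of_nhds).symm)
  have hint := integrableOn_Ioi_deriv_of_nonneg hcont hderiv hpos htop'
  have hval := integral_Ioi_of_hasDerivAt_of_nonneg hcont hderiv hpos htop'
  rw [← ofReal_integral_eq_lintegral_ofReal hint
    ((ae_restrict_iff' measurableSet_Ioi).mpr (Filter.Eventually.of_forall hpos)), hval, hF0, hL]
  congr 1
  field_simp
  ring

theorem stmt_4 (p q : ℝ) (hp : 0 < p) (hq : 0 < q) (g : ℝ → ℝ)
    (hg : Measurable g) (hg0 : ∀ t, 0 ≤ g t) :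
    (∫⁻ x in Set.Ioi (0:ℝ), ∫⁻ y in Set.Ioi (0:ℝ),
        ENNReal.ofReal ((y ^ ((5:ℝ)/2) / (x ^ ((1:ℝ)/2) * (x + y) ^ 2)) *
          g (x * y / (x + y)) * Real.exp (-p * x - q * y)))
    = ENNReal.ofReal (Real.sqrt Real.pi / (2 * q ^ ((3:ℝ)/2))) *
      ∫⁻ t in Set.Ioi (0:ℝ),
        ENNReal.ofReal (g t * t ^ (-(1:ℝ)/2) * (1 + 2 * Real.sqrt p * Real.sqrt q * t) *
          Real.exp (-(Real.sqrt p + Real.sqrt q) ^ 2 * t)) := by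
  have r52 : ∀ y : ℝ, 0 < y → y ^ ((5:ℝ)/2) = y ^ 2 * √y := by
    intro y hy
    rw [Real.sqrt_eq_rpow, ← Real.rpow_natCast, ← Real.rpow_add hy]; norm_num
  have r32 : q ^ ((3:ℝ)/2) = √q ^ 3 := by
    rw [Real.sqrt_eq_rpow, ← Real.rpow_natCast, ← Real.rpow_mul hq.le]; norm_num
  -- step 1: y = x s
  have s1 : ∀ x ∈ Set.Ioi (0:ℝ), (∫⁻ y in Set.Ioi (0:ℝ),
        ENNReal.ofReal ((y ^ ((5:ℝ)/2) / (x ^ ((1:ℝ)/2) * (x + y) ^ 2)) *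
          g (x * y / (x + y)) * Real.exp (-p * x - q * y)))
      = ∫⁻ s in Set.Ioi (0:ℝ), ENNReal.ofReal (x * (s ^ 2 * √s) / (1 + s) ^ 2 *
          g (x * (s / (1 + s))) * Real.exp (-p * x - q * (x * s))) := by
    intro x hx
    have hx' : 0 < x := hx
    rw [aux_scale _ x hx]
    refine setLIntegral_congr_fun measurableSet_Ioi (fun s hs => ?_)
    have hs' : 0 < s := hs
    rw [← ENNReal.ofReal_mul hx'.le]
    congr 1
    have e1 : x * (x * s) / (x + x * s) = x * (s / (1 + s)) := by field_simp
    rw [e1, r52 _ (by positivity), ← Real.sqrt_eq_rpow, Real.sqrt_mul hx'.le]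
    have : 0 < √x := Real.sqrt_pos.mpr hx'
    field_simp
  rw [setLIntegral_congr_fun measurableSet_Ioi s1, lintegral_lintegral_swap (by fun_prop)]
  -- step 2: x = t (1 + s) / s
  have s2 : ∀ s ∈ Set.Ioi (0:ℝ), (∫⁻ x in Set.Ioi (0:ℝ),
        ENNReal.ofReal (x * (s ^ 2 * √s) / (1 + s) ^ 2 *
          g (x * (s / (1 + s))) * Real.exp (-p * x - q * (x * s))))
      = ∫⁻ t in Set.Ioi (0:ℝ), ENNReal.ofReal (t * g t) *
          ENNReal.ofReal (√s * Real.exp (-p * (t * (1 + 1 / s)) - q * (t * (1 + s)))) := by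
    intro s hs
    have hs' : 0 < s := hs
    have hc : 0 < (1 + s) / s := by positivity
    rw [aux_scale _ ((1 + s) / s) hc]
    refine setLIntegral_congr_fun measurableSet_Ioi (fun t ht => ?_)
    have ht' : 0 < t := ht
    rw [← ENNReal.ofReal_mul hc.le, ← ENNReal.ofReal_mul (mul_nonneg ht'.le (hg0 t))]
    congr 1
    have e1 : (1 + s) / s * t * (s / (1 + s)) = t := by field_simp
    have e2 : -p * ((1 + s) / s * t) - q * ((1 + s) / s * t * s)
        = -p * (t * (1 + 1 / s)) - q * (t * (1 + s)) := by field_simp; ring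
    rw [e1, e2]
    field_simp
  rw [setLIntegral_congr_fun measurableSet_Ioi s2, lintegral_lintegral_swap (by fun_prop),
    ← lintegral_const_mul _ (by fun_prop)]
  refine setLIntegral_congr_fun measurableSet_Ioi (fun t ht => ?_)
  have ht' : 0 < t := ht
  have hst : 0 < √t := Real.sqrt_pos.mpr ht'
  have hsp : 0 < √p := Real.sqrt_pos.mpr hp
  have hsq : 0 < √q := Real.sqrt_pos.mpr hq
  have hpp : √p ^ 2 = p := Real.sq_sqrt hp.le
  have hqq : √q ^ 2 = q := Real.sq_sqrt hq.le
  have htt : √t ^ 2 = t := Real.sq_sqrt ht'.le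
  rw [lintegral_const_mul _ (by fun_prop)]
  have s3 : ∀ s ∈ Set.Ioi (0:ℝ),
      ENNReal.ofReal (√s * Real.exp (-p * (t * (1 + 1 / s)) - q * (t * (1 + s))))
      = ENNReal.ofReal (Real.exp (-(√p + √q) ^ 2 * t)) *
        ENNReal.ofReal (√s * Real.exp (-(√q * √t * √s - √p * √t / √s) ^ 2)) := by
    intro s hs
    have hs' : 0 < s := hs
    have hss : 0 < √s := Real.sqrt_pos.mpr hs'
    have hs2 : √s ^ 2 = s := Real.sq_sqrt hs'.le
    rw [← ENNReal.ofReal_mul (Real.exp_pos _).le, mul_left_comm (Real.exp _) (√s), ← Real.exp_add]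
    congr 3
    have : (√q * √t * √s - √p * √t / √s) ^ 2 = q * t * s - 2 * √p * √q * t + p * t / s := by
      have h : (√q * √t * √s - √p * √t / √s) ^ 2 = √q ^ 2 * √t ^ 2 * √s ^ 2
          - 2 * √p * √q * √t ^ 2 + √p ^ 2 * √t ^ 2 / √s ^ 2 := by
        field_simp
        ring
      rw [h, hpp, hqq, htt, hs2]
    rw [neg_mul, add_sq, hpp, hqq, this]
    field_simp
    ring
  rw [setLIntegral_congr_fun measurableSet_Ioi s3, lintegral_const_mul _ (by fun_prop),
    aux_key _ _ (by positivity) (by positivity), ← ENNReal.ofReal_mul (by positivity),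
    ← ENNReal.ofReal_mul (mul_nonneg ht'.le (hg0 t)), ← ENNReal.ofReal_mul (by positivity), r32]
  congr 1
  have r12 : t ^ (-(1:ℝ)/2) = 1 / √t := by
    rw [neg_div, Real.rpow_neg ht'.le, ← Real.sqrt_eq_rpow, one_div]
  rw [r12]
  have e : √p * √t * (√q * √t) = √p * √q * t := by
    rw [← htt]; simp only [Real.sqrt_sq hst.le]; ring
  have e3 : 1 + 2 * (√p * √t) * (√q * √t) = 1 + 2 * √p * √q * t := by linear_combination 2 * e
  rw [e3]
  have e4 : t / (√q * √t) ^ 3 = 1 / √q ^ 3 * (1 / √t) := by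
    field_simp
    exact htt.symm
  linear_combination (g t * Real.exp (-(√p + √q) ^ 2 * t) * √π / 2 * (1 + 2 * √p * √q * t)) * e4
end

section
/- Let p, q be positive reals and let f : ℝ → ℝ be a nonnegative measurable function. Then ∫₀^∞ ∫₀^∞ (1/(x·y)) · f(xy/(x+y)) · exp(-p·x - q·y) dx dy = 2 · ∫₀^∞ f(t) · t^(-1) · exp(-(p+q)·t) · K₀(2·√p·√q·t) dt. -/
open MeasureTheory Real

/-- Modified Bessel function of the second kind, via its integral representation
`K_ν(z) = ∫₀^∞ exp(-z cosh u) cosh (ν u) du`. -/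
noncomputable def besselK (ν : ℝ) (z : ℝ) : ℝ :=
  ∫ u in Set.Ioi (0:ℝ), Real.exp (-z * Real.cosh u) * Real.cosh (ν * u)

theorem aux_integrable (z : ℝ) (hz : 0 < z) :
    Integrable (fun u : ℝ => Real.exp (-z * Real.cosh u)) := by
  refine (integrable_exp_neg_mul_sq (b := z / 4) (by positivity)).mono' ?_ ?_
  · exact Continuous.aestronglyMeasurable (by fun_prop)
  · refine Filter.Eventually.of_forall fun u => ?_
    rw [Real.norm_eq_abs, abs_of_pos (Real.exp_pos _)]
    apply Real.exp_le_exp.2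
    have h1 := Real.quadratic_le_exp_of_nonneg (abs_nonneg u)
    have h2 : Real.exp |u| / 2 ≤ Real.cosh u := by
      rw [← Real.cosh_abs, Real.cosh_eq]
      have := Real.exp_pos (-|u|)
      linarith
    have h3 : u ^ 2 / 4 ≤ Real.cosh u := by
      rw [sq_abs] at h1
      have := abs_nonneg u
      linarith
    nlinarith

theorem aux_bessel (z : ℝ) (hz : 0 < z) :
    ∫⁻ u : ℝ, ENNReal.ofReal (Real.exp (-z * Real.cosh u))
      = 2 * ENNReal.ofReal (besselK 0 z) := by
  rw [← ofReal_integral_eq_lintegral_ofReal (aux_integrable z hz)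
    (Filter.Eventually.of_forall fun u => (Real.exp_pos _).le)]
  have h := integral_comp_abs (f := fun u : ℝ => Real.exp (-z * Real.cosh u))
  simp only [Real.cosh_abs] at h
  rw [h, ENNReal.ofReal_mul (by norm_num)]
  simp [besselK]

theorem aux_expsub (b : ℝ) (hb : 0 < b) (g : ℝ → ENNReal) :
    ∫⁻ y in Set.Ioi (0:ℝ), g y
      = ∫⁻ v : ℝ, ENNReal.ofReal (b * Real.exp v) * g (b * Real.exp v) := by
  have him : (fun v : ℝ => b * Real.exp v) '' Set.univ = Set.Ioi 0 := by
    ext y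
    simp only [Set.image_univ, Set.mem_range, Set.mem_Ioi]
    constructor
    · rintro ⟨v, rfl⟩
      positivity
    · intro hy
      refine ⟨Real.log (y / b), ?_⟩
      rw [Real.exp_log (by positivity)]
      field_simp
  have h := lintegral_image_eq_lintegral_abs_deriv_mul (s := Set.univ)
    (f := fun v : ℝ => b * Real.exp v) (f' := fun v : ℝ => b * Real.exp v) MeasurableSet.univ
    (fun v _ => ((Real.hasDerivAt_exp v).const_mul b).hasDerivWithinAt)
    (fun v _ w _ hvw => by
      have := mul_left_cancel₀ hb.ne' hvw
      exact Real.exp_injective this) g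
  rw [him] at h
  rw [h, Measure.restrict_univ]
  refine lintegral_congr fun v => ?_
  rw [abs_of_pos (by positivity)]

theorem aux_linsub (b : ℝ) (hb : 0 < b) (g : ℝ → ENNReal) :
    ∫⁻ x in Set.Ioi (0:ℝ), g x
      = ∫⁻ t in Set.Ioi (0:ℝ), ENNReal.ofReal b * g (b * t) := by
  have him : (fun v : ℝ => b * v) '' Set.Ioi 0 = Set.Ioi 0 := by
    ext y
    simp only [Set.mem_image, Set.mem_Ioi]
    constructor
    · rintro ⟨v, hv, rfl⟩
      positivity
    · intro hy
      refine ⟨y / b, by positivity, ?_⟩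
      field_simp
  have h := lintegral_image_eq_lintegral_abs_deriv_mul (s := Set.Ioi (0:ℝ))
    (f := fun v : ℝ => b * v) (f' := fun _ : ℝ => b) measurableSet_Ioi
    (fun v _ => by simpa using ((hasDerivAt_id v).const_mul b).hasDerivWithinAt)
    (fun v _ w _ hvw => mul_left_cancel₀ hb.ne' hvw) g
  rw [him] at h
  rw [h, abs_of_pos hb]

theorem stmt_6 (p q : ℝ) (hp : 0 < p) (hq : 0 < q) (f : ℝ → ℝ)
    (hf : Measurable f) (hf0 : ∀ t, 0 ≤ f t) :
    (∫⁻ x in Set.Ioi (0:ℝ), ∫⁻ y in Set.Ioi (0:ℝ),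
        ENNReal.ofReal ((1 / (x * y)) * f (x * y / (x + y)) * Real.exp (-p * x - q * y)))
    = 2 *
      ∫⁻ t in Set.Ioi (0:ℝ),
        ENNReal.ofReal (f t * t⁻¹ * Real.exp (-(p + q) * t) *
          besselK 0 (2 * Real.sqrt p * Real.sqrt q * t)) := by
  obtain ⟨r, hr, rfl⟩ : ∃ r : ℝ, 0 < r ∧ r ^ 2 = p :=
    ⟨√p, Real.sqrt_pos.2 hp, Real.sq_sqrt hp.le⟩
  obtain ⟨s, hs, rfl⟩ : ∃ s : ℝ, 0 < s ∧ s ^ 2 = q :=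
    ⟨√q, Real.sqrt_pos.2 hq, Real.sq_sqrt hq.le⟩
  rw [Real.sqrt_sq hr.le, Real.sqrt_sq hs.le]
  -- step 1
  have h1 : ∀ x ∈ Set.Ioi (0:ℝ), (∫⁻ y in Set.Ioi (0:ℝ),
        ENNReal.ofReal ((1 / (x * y)) * f (x * y / (x + y)) * Real.exp (-r^2 * x - s^2 * y)))
      = ∫⁻ v : ℝ, ENNReal.ofReal (1 / x * f (x / (1 + s / r * Real.exp (-v))) *
          Real.exp (-x * (r ^ 2 + r * s * Real.exp v))) := by
    intro x hx
    have hx : 0 < x := hx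
    rw [aux_expsub (x * (r / s)) (by positivity)]
    refine lintegral_congr fun v => ?_
    rw [← ENNReal.ofReal_mul (by positivity)]
    have e1 : x * (x * (r / s) * Real.exp v) / (x + x * (r / s) * Real.exp v)
        = x / (1 + s / r * Real.exp (-v)) := by
      rw [Real.exp_neg]
      have := Real.exp_pos v
      field_simp
      ring
    have e2 : -r ^ 2 * x - s ^ 2 * (x * (r / s) * Real.exp v)
        = -x * (r ^ 2 + r * s * Real.exp v) := by
      field_simp
      ring
    rw [e1, e2]
    congr 1
    have := Real.exp_pos v
    field_simp
  rw [setLIntegral_congr_fun measurableSet_Ioi h1]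
  rw [lintegral_lintegral_swap (by
    apply Measurable.aemeasurable
    unfold Function.uncurry
    fun_prop)]
  have h2 : ∀ v : ℝ, (∫⁻ x in Set.Ioi (0:ℝ),
        ENNReal.ofReal (1 / x * f (x / (1 + s / r * Real.exp (-v))) *
          Real.exp (-x * (r ^ 2 + r * s * Real.exp v))))
      = ∫⁻ t in Set.Ioi (0:ℝ), ENNReal.ofReal (f t * t⁻¹ * Real.exp (-(r ^ 2 + s ^ 2) * t)) *
          ENNReal.ofReal (Real.exp (-(2 * r * s * t) * Real.cosh v)) := by
    intro v
    have hb : 0 < 1 + s / r * Real.exp (-v) := by positivity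
    rw [aux_linsub _ hb]
    refine setLIntegral_congr_fun measurableSet_Ioi fun t ht => ?_
    have ht : 0 < t := ht
    have := hf0 t
    beta_reduce
    rw [← ENNReal.ofReal_mul hb.le, ← ENNReal.ofReal_mul (by positivity),
      mul_div_cancel_left₀ _ hb.ne']
    have e : -((1 + s / r * Real.exp (-v)) * t) * (r ^ 2 + r * s * Real.exp v)
        = -(r ^ 2 + s ^ 2) * t + -(2 * r * s * t) * Real.cosh v := by
      rw [Real.cosh_eq, Real.exp_neg]
      have := Real.exp_pos v
      field_simp
      ring
    rw [e, Real.exp_add]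
    congr 1
    generalize 1 + s / r * Real.exp (-v) = b at hb
    field_simp
  simp_rw [h2]
  rw [lintegral_lintegral_swap (by
    apply Measurable.aemeasurable
    unfold Function.uncurry
    fun_prop)]
  rw [← lintegral_const_mul' _ _ (by norm_num)]
  refine setLIntegral_congr_fun measurableSet_Ioi fun t ht => ?_
  have ht : 0 < t := ht
  have := hf0 t
  beta_reduce
  rw [lintegral_const_mul' _ _ ENNReal.ofReal_ne_top, aux_bessel _ (by positivity),
    ENNReal.ofReal_mul (p := f t * t⁻¹ * Real.exp (-(r ^ 2 + s ^ 2) * t)) (by positivity)]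
  ring
end

section
/- Let p, q be positive reals and let g : ℝ → ℝ be a nonnegative measurable function. Then ∫₀^∞ ∫₀^∞ (y^(3/2)/(x^(1/2)·(x+y)^(3/2))) · g(xy/(x+y)) · exp(-p·x - q·y) dx dy = 2·(√p/√q) · ∫₀^∞ g(t) · t^(1/2) · exp(-(p+q)·t) · K₁(2·√p·√q·t) dt. -/
open MeasureTheory Real

theorem scale_aux (c : ℝ) (hc : 0 < c) (F : ℝ → ENNReal) :
    ∫⁻ y in Set.Ioi (0:ℝ), F y = ∫⁻ w in Set.Ioi (0:ℝ), ENNReal.ofReal c * F (c * w) := by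
  have him : Set.image (fun w : ℝ => c * w) (Set.Ioi 0) = Set.Ioi 0 := by
    ext y
    simp only [Set.mem_image, Set.mem_Ioi]
    constructor
    · rintro ⟨w, hw, rfl⟩
      positivity
    · intro hy
      exact ⟨y / c, by positivity, by field_simp⟩
  have h := lintegral_image_eq_lintegral_abs_deriv_mul (s := Set.Ioi (0:ℝ))
    (f := fun w : ℝ => c * w) (f' := fun _ => c) measurableSet_Ioi
    (fun x _ => by simpa using ((hasDerivAt_id x).const_mul c).hasDerivWithinAt)
    (fun a _ b _ hab => by simpa [hc.ne'] using hab) F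
  rw [him] at h
  rw [h, abs_of_pos hc]

theorem exp_aux (c : ℝ) (hc : 0 < c) (F : ℝ → ENNReal) :
    ∫⁻ y in Set.Ioi (0:ℝ), F y
      = ∫⁻ u : ℝ, ENNReal.ofReal (c * Real.exp u) * F (c * Real.exp u) := by
  have him : Set.image (fun w : ℝ => c * Real.exp w) (Set.univ) = Set.Ioi 0 := by
    ext y
    simp only [Set.mem_image, Set.mem_Ioi, Set.mem_univ, true_and]
    constructor
    · rintro ⟨w, rfl⟩
      positivity
    · intro hy
      exact ⟨Real.log (y / c), by rw [Real.exp_log (by positivity)]; field_simp⟩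
  have h := lintegral_image_eq_lintegral_abs_deriv_mul (s := Set.univ)
    (f := fun w : ℝ => c * Real.exp w) (f' := fun w => c * Real.exp w) MeasurableSet.univ
    (fun x _ => ((Real.hasDerivAt_exp x).const_mul c).hasDerivWithinAt)
    (fun a _ b _ hab => by simpa [hc.ne'] using hab) F
  rw [him] at h
  rw [h, Measure.restrict_univ]
  refine lintegral_congr fun u => ?_
  rw [abs_of_pos (by positivity)]

theorem fold_aux (F : ℝ → ENNReal) (hF : Measurable F) :
    ∫⁻ u : ℝ, F u = ∫⁻ u in Set.Ioi (0:ℝ), (F u + F (-u)) := by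
  have him : Set.image (fun w : ℝ => -w) (Set.Ioi 0) = Set.Iio 0 := by
    simp
  have h := lintegral_image_eq_lintegral_abs_deriv_mul (s := Set.Ioi (0:ℝ))
    (f := fun w : ℝ => -w) (f' := fun w => -1) measurableSet_Ioi
    (fun x _ => (hasDerivAt_neg x).hasDerivWithinAt)
    (fun a _ b _ hab => by simpa using hab) F
  rw [him] at h
  rw [lintegral_add_left hF, ← lintegral_add_compl F (measurableSet_Ioi (a := (0:ℝ))),
    Set.compl_Ioi, setLIntegral_congr (Iio_ae_eq_Iic (a := (0:ℝ))).symm, h]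
  simp

theorem besselK_integrable (z : ℝ) (hz : 0 < z) :
    IntegrableOn (fun u => Real.exp (-z * Real.cosh u) * Real.cosh (1 * u)) (Set.Ioi (0:ℝ)) := by
  have h1 : IntegrableOn (fun u : ℝ => (4 / z ^ 2) * Real.exp (-u)) (Set.Ioi (0:ℝ)) :=
    (integrableOn_exp_neg_Ioi 0).const_mul _
  refine Integrable.mono' h1 ?_ ?_
  · exact (by fun_prop : Continuous (fun u : ℝ =>
      Real.exp (-z * Real.cosh u) * Real.cosh (1 * u))).aestronglyMeasurable
  · refine Filter.Eventually.of_forall fun u => ?_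
    have hc : 0 < Real.cosh u := Real.cosh_pos u
    rw [Real.norm_of_nonneg (by rw [one_mul]; positivity), one_mul, neg_mul, Real.exp_neg,
      Real.exp_neg]
    have hq := Real.quadratic_le_exp_of_nonneg (x := z * Real.cosh u) (by positivity)
    have h2 : Real.exp u ≤ 2 * Real.cosh u := by
      rw [Real.cosh_eq]; linarith [Real.exp_pos (-u)]
    have hzc : 0 < z * Real.cosh u := by positivity
    rw [← div_eq_inv_mul, ← div_eq_mul_inv, div_div,
      div_le_div_iff₀ (by positivity) (by positivity)]
    have h3 : Real.cosh u * (z ^ 2 * Real.exp u) ≤ Real.cosh u * (z ^ 2 * (2 * Real.cosh u)) := by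
      gcongr
    nlinarith

theorem inner_aux (p q : ℝ) (hp : 0 < p) (hq : 0 < q) (t : ℝ) (ht : 0 < t) :
    ∫⁻ w in Set.Ioi (0:ℝ), ENNReal.ofReal (Real.exp (-t * (p / w + q * w)))
      = ENNReal.ofReal (2 * (Real.sqrt p / Real.sqrt q)) *
        ENNReal.ofReal (besselK 1 (2 * Real.sqrt p * Real.sqrt q * t)) := by
  obtain ⟨a, ha, rfl⟩ : ∃ a : ℝ, 0 < a ∧ p = a ^ 2 :=
    ⟨√p, by positivity, (Real.sq_sqrt hp.le).symm⟩
  obtain ⟨b, hb, rfl⟩ : ∃ b : ℝ, 0 < b ∧ q = b ^ 2 :=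
    ⟨√q, by positivity, (Real.sq_sqrt hq.le).symm⟩
  rw [Real.sqrt_sq ha.le, Real.sqrt_sq hb.le]
  rw [exp_aux (a / b) (by positivity), fold_aux _ (by fun_prop), besselK,
    ofReal_integral_eq_lintegral_ofReal (besselK_integrable _ (by positivity))
    (Filter.Eventually.of_forall fun u => by
      have := Real.cosh_pos (1 * u)
      simp only [Pi.zero_apply]
      positivity), ← lintegral_const_mul _ (by fun_prop)]
  refine lintegral_congr fun u => ?_
  rw [← ENNReal.ofReal_mul (by positivity), ← ENNReal.ofReal_mul (by positivity),
    ← ENNReal.ofReal_mul (by positivity), ← ENNReal.ofReal_add (by positivity) (by positivity)]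
  congr 1
  have e1 : -t * (a ^ 2 / (a / b * Real.exp u) + b ^ 2 * (a / b * Real.exp u))
      = -(2 * a * b * t) * Real.cosh u := by
    rw [Real.cosh_eq, Real.exp_neg]
    have := Real.exp_pos u
    field_simp
    ring
  have e2 : -t * (a ^ 2 / (a / b * Real.exp (-u)) + b ^ 2 * (a / b * Real.exp (-u)))
      = -(2 * a * b * t) * Real.cosh u := by
    rw [Real.cosh_eq, Real.exp_neg]
    have := Real.exp_pos u
    field_simp
  rw [e1, e2, one_mul]
  generalize Real.exp (-(2 * a * b * t) * Real.cosh u) = E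
  rw [Real.cosh_eq]
  ring

theorem weight_aux (w t : ℝ) (hw : 0 < w) (ht : 0 < t) (x : ℝ) (hx : x = (1 + w) / w * t) :
    (1 + w) / w * (x * ((x * w) ^ ((3:ℝ)/2) / (x ^ ((1:ℝ)/2) * (x + x * w) ^ ((3:ℝ)/2))))
      = t ^ ((1:ℝ)/2) := by
  have hx0 : 0 < x := by rw [hx]; positivity
  have e : x + x * w = x * (1 + w) := by ring
  have hS : ∀ s : ℝ, 0 < s → s ^ ((3:ℝ)/2) = s * √s := by
    intro s hs
    rw [show (3:ℝ)/2 = 1 + 1/2 by norm_num, Real.rpow_add hs, Real.rpow_one, Real.sqrt_eq_rpow]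
  rw [hS _ (by positivity), hS _ (by positivity), ← Real.sqrt_eq_rpow, ← Real.sqrt_eq_rpow, e]
  have ht' : t = x * w / (1 + w) := by rw [hx]; field_simp
  have h1 : √t = √(x * w) / √(1 + w) := by rw [ht', Real.sqrt_div (by positivity)]
  have h2 : √(x * (1 + w)) = √x * √(1 + w) := Real.sqrt_mul hx0.le _
  have h3 : 0 < √x := by positivity
  have h4 : 0 < √(1 + w) := by positivity
  have h5 : √x * √x = x := Real.mul_self_sqrt hx0.le
  rw [h1, h2]
  field_simp
  nlinarith

theorem stmt_8 (p q : ℝ) (hp : 0 < p) (hq : 0 < q) (g : ℝ → ℝ)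
    (hg : Measurable g) (hg0 : ∀ t, 0 ≤ g t) :
    (∫⁻ x in Set.Ioi (0:ℝ), ∫⁻ y in Set.Ioi (0:ℝ),
        ENNReal.ofReal ((y ^ ((3:ℝ)/2) / (x ^ ((1:ℝ)/2) * (x + y) ^ ((3:ℝ)/2))) *
          g (x * y / (x + y)) * Real.exp (-p * x - q * y)))
    = ENNReal.ofReal (2 * (Real.sqrt p / Real.sqrt q)) *
      ∫⁻ t in Set.Ioi (0:ℝ),
        ENNReal.ofReal (g t * t ^ ((1:ℝ)/2) * Real.exp (-(p + q) * t) *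
          besselK 1 (2 * Real.sqrt p * Real.sqrt q * t)) := by
  set F : ℝ → ℝ → ENNReal := fun x y =>
    ENNReal.ofReal ((y ^ ((3:ℝ)/2) / (x ^ ((1:ℝ)/2) * (x + y) ^ ((3:ℝ)/2))) *
          g (x * y / (x + y)) * Real.exp (-p * x - q * y)) with hF
  have s1 : ∫⁻ x in Set.Ioi (0:ℝ), ∫⁻ y in Set.Ioi (0:ℝ), F x y
      = ∫⁻ x in Set.Ioi (0:ℝ), ∫⁻ w in Set.Ioi (0:ℝ), ENNReal.ofReal x * F x (x * w) :=
    setLIntegral_congr_fun measurableSet_Ioi fun x hx => scale_aux x hx (F x)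
  have s3 : ∫⁻ w in Set.Ioi (0:ℝ), ∫⁻ x in Set.Ioi (0:ℝ), ENNReal.ofReal x * F x (x * w)
      = ∫⁻ w in Set.Ioi (0:ℝ), ∫⁻ t in Set.Ioi (0:ℝ),
        ENNReal.ofReal (g t * t ^ ((1:ℝ)/2) * Real.exp (-(p + q) * t)) *
          ENNReal.ofReal (Real.exp (-t * (p / w + q * w))) := by
    refine setLIntegral_congr_fun measurableSet_Ioi fun w hw => ?_
    have hw : 0 < w := hw
    rw [scale_aux ((1 + w) / w) (by positivity)]
    refine setLIntegral_congr_fun measurableSet_Ioi fun t ht => ?_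
    have ht : 0 < t := ht
    simp only [hF]
    have hgt := hg0 t
    have hW := weight_aux w t hw ht _ rfl
    have e1 : ((1 + w) / w * t) * ((1 + w) / w * t * w)
        / ((1 + w) / w * t + (1 + w) / w * t * w) = t := by
      field_simp
    have e2 : -p * ((1 + w) / w * t) - q * ((1 + w) / w * t * w)
        = -(p + q) * t + -t * (p / w + q * w) := by
      field_simp
      ring
    rw [e1, e2, Real.exp_add, ← ENNReal.ofReal_mul (by positivity),
      ← ENNReal.ofReal_mul (by positivity), ← ENNReal.ofReal_mul (by positivity), ← hW]
    congr 1
    ring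
  rw [s1, lintegral_lintegral_swap, s3, lintegral_lintegral_swap,
    ← lintegral_const_mul' _ _ ENNReal.ofReal_ne_top]
  · refine setLIntegral_congr_fun measurableSet_Ioi fun t ht => ?_
    have ht : 0 < t := ht
    have hgt := hg0 t
    rw [lintegral_const_mul _ (by fun_prop), inner_aux p q hp hq t ht,
      ENNReal.ofReal_mul (p := g t * t ^ ((1:ℝ)/2) * Real.exp (-(p + q) * t)) (by positivity)]
    ring
  · apply Measurable.aemeasurable
    unfold Function.uncurry
    fun_prop
  · apply Measurable.aemeasurable
    unfold Function.uncurry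
    simp only [hF]
    fun_prop
end

section
/- Let a, b, c be reals with a > b > 0 and c > 0, and let f : ℝ → ℝ be a nonnegative measurable function. Then ∫₀^∞ ∫₀^∞ x^(-3/2)·y^(-3/2)·(x+y)^(-3/2) · f(xy/(x+y)) · exp(-a/x - b/y - c·xy/(x+y)) dx dy = (a-b)^(-3) · ∫₀^∞ f(t) · t^(-3/2) · exp(-c·t) · ((a-b-2·t)·exp(-b/t) + (a-b+2·t)·exp(-a/t)) dt. -/
open MeasureTheory Real

lemma aux_rpow (x t : ℝ) (ht : 0 < t) (hx : t < x) :
    x ^ 2 / (x - t) ^ 2 * (x ^ (-(3:ℝ)/2) * (x * t / (x - t)) ^ (-(3:ℝ)/2) *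
      (x + x * t / (x - t)) ^ (-(3:ℝ)/2)) = (x - t) / x ^ 4 * t ^ (-(3:ℝ)/2) := by
  have hx0 : 0 < x := ht.trans hx
  have hp : 0 < x - t := sub_pos.2 hx
  have e : x + x * t / (x - t) = x * x / (x - t) := by field_simp; ring
  have key : ∀ z : ℝ, 0 < z → z ^ (-(3:ℝ)/2) * z ^ (-(3:ℝ)/2) = (z ^ 3)⁻¹ := by
    intro z hz
    rw [← Real.rpow_add hz, ← Real.rpow_natCast z 3, ← Real.rpow_neg hz.le]
    norm_num
  rw [e, Real.div_rpow (by positivity) hp.le, Real.div_rpow (by positivity) hp.le,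
    Real.mul_rpow hx0.le ht.le, Real.mul_rpow hx0.le hx0.le]
  have h1 := key x hx0
  have h2 := key (x - t) hp
  have e2 : x ^ 2 / (x - t) ^ 2 * (x ^ (-(3:ℝ)/2) * (x ^ (-(3:ℝ)/2) * t ^ (-(3:ℝ)/2) /
      (x - t) ^ (-(3:ℝ)/2)) * (x ^ (-(3:ℝ)/2) * x ^ (-(3:ℝ)/2) / (x - t) ^ (-(3:ℝ)/2)))
      = x ^ 2 / (x - t) ^ 2 * ((x ^ (-(3:ℝ)/2) * x ^ (-(3:ℝ)/2)) *
        (x ^ (-(3:ℝ)/2) * x ^ (-(3:ℝ)/2)) / ((x - t) ^ (-(3:ℝ)/2) * (x - t) ^ (-(3:ℝ)/2)))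
        * t ^ (-(3:ℝ)/2) := by
    field_simp
  rw [e2, h1, h2]
  congr 1
  field_simp

lemma aux_image (x : ℝ) (hx : 0 < x) :
    (fun t : ℝ => x * t / (x - t)) '' Set.Ioo 0 x = Set.Ioi 0 := by
  ext y
  simp only [Set.mem_image, Set.mem_Ioo, Set.mem_Ioi]
  constructor
  · rintro ⟨t, ⟨h0, h1⟩, rfl⟩
    have := sub_pos.2 h1
    positivity
  · intro hy
    refine ⟨x * y / (x + y), ⟨by positivity, ?_⟩, ?_⟩
    · rw [div_lt_iff₀ (by positivity)]; nlinarith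
    · have : x - x * y / (x + y) = x * x / (x + y) := by field_simp; ring
      rw [this]; field_simp

lemma aux_inj (x : ℝ) (hx : 0 < x) :
    Set.InjOn (fun t : ℝ => x * t / (x - t)) (Set.Ioo 0 x) := by
  intro s hs t ht h
  have h1 := sub_pos.2 hs.2
  have h2 := sub_pos.2 ht.2
  simp only at h
  rw [div_eq_div_iff h1.ne' h2.ne'] at h
  have : x * x * (s - t) = 0 := by linear_combination h
  rcases mul_eq_zero.1 this with h | h
  · nlinarith
  · linarith

lemma aux_deriv (x t : ℝ) (h : t < x) :
    HasDerivAt (fun t : ℝ => x * t / (x - t)) (x ^ 2 / (x - t) ^ 2) t := by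
  have hp := sub_pos.2 h
  have := ((hasDerivAt_id t).const_mul x).div ((hasDerivAt_id t).const_sub x) hp.ne'
  refine this.congr_deriv ?_
  congr 1
  simp only [id]
  ring

lemma aux_hasDeriv (d t x : ℝ) (hd : 0 < d) (hx : 0 < x) :
    HasDerivAt (fun x : ℝ => Real.exp (-d * x⁻¹) *
      (-(t / d) * x⁻¹ ^ 2 + (d - 2 * t) / d ^ 2 * x⁻¹ + (d - 2 * t) / d ^ 3))
      ((x - t) / x ^ 4 * Real.exp (-d * x⁻¹)) x := by
  have hi := hasDerivAt_inv hx.ne'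
  have h1 := (hi.const_mul (-d)).exp
  have h2 := (((hi.pow 2).const_mul (-(t/d))).add (hi.const_mul ((d - 2 * t) / d ^ 2))).add_const
    ((d - 2 * t) / d ^ 3)
  have := h1.mul h2
  refine this.congr_deriv ?_
  simp
  field_simp
  ring

lemma aux_int (d t : ℝ) (hd : 0 < d) (ht : 0 < t) :
    ∫⁻ x in Set.Ioi t, ENNReal.ofReal ((x - t) / x ^ 4 * Real.exp (-d * x⁻¹)) =
      ENNReal.ofReal (((d - 2 * t) + (d + 2 * t) * Real.exp (-d / t)) / d ^ 3) := by
  have hder : ∀ x ∈ Set.Ici t, HasDerivAt (fun x : ℝ => Real.exp (-d * x⁻¹) *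
      (-(t / d) * x⁻¹ ^ 2 + (d - 2 * t) / d ^ 2 * x⁻¹ + (d - 2 * t) / d ^ 3))
      ((x - t) / x ^ 4 * Real.exp (-d * x⁻¹)) x :=
    fun x hx => aux_hasDeriv d t x hd (lt_of_lt_of_le ht hx)
  have hpos : ∀ x ∈ Set.Ioi t, 0 ≤ (x - t) / x ^ 4 * Real.exp (-d * x⁻¹) := by
    intro x hx
    have : 0 < x - t := sub_pos.2 hx
    positivity
  have hlim : Filter.Tendsto (fun x : ℝ => Real.exp (-d * x⁻¹) *
      (-(t / d) * x⁻¹ ^ 2 + (d - 2 * t) / d ^ 2 * x⁻¹ + (d - 2 * t) / d ^ 3)) Filter.atTop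
      (nhds ((d - 2 * t) / d ^ 3)) := by
    have hc : Continuous (fun w : ℝ => Real.exp (-d * w) *
      (-(t / d) * w ^ 2 + (d - 2 * t) / d ^ 2 * w + (d - 2 * t) / d ^ 3)) := by fun_prop
    have := (hc.tendsto 0).comp (tendsto_inv_atTop_zero (𝕜 := ℝ))
    simpa [Function.comp_def] using this
  have hI := integrableOn_Ioi_deriv_of_nonneg' hder hpos hlim
  have hE := integral_Ioi_of_hasDerivAt_of_nonneg' hder hpos hlim
  rw [← ofReal_integral_eq_lintegral_ofReal hI
    ((ae_restrict_iff' measurableSet_Ioi).2 (Filter.Eventually.of_forall hpos)), hE]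
  congr 1
  rw [← div_eq_mul_inv]
  field_simp
  ring

theorem stmt_13 (a b c : ℝ) (hab : a > b) (hb : b > 0) (hc : c > 0) (f : ℝ → ℝ)
    (hf : Measurable f) (hf0 : ∀ t, 0 ≤ f t) :
    (∫⁻ x in Set.Ioi (0:ℝ), ∫⁻ y in Set.Ioi (0:ℝ),
        ENNReal.ofReal (x ^ (-(3:ℝ)/2) * y ^ (-(3:ℝ)/2) * (x + y) ^ (-(3:ℝ)/2) *
          f (x * y / (x + y)) *
          Real.exp (-a / x - b / y - c * (x * y / (x + y)))))
    = ENNReal.ofReal ((a - b) ^ (-(3:ℝ))) *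
      ∫⁻ t in Set.Ioi (0:ℝ),
        ENNReal.ofReal (f t * t ^ (-(3:ℝ)/2) * Real.exp (-c * t) *
          ((a - b - 2 * t) * Real.exp (-b / t) + (a - b + 2 * t) * Real.exp (-a / t))) := by
  have hd : 0 < a - b := sub_pos.2 hab
  let W : ℝ → ℝ := fun t => f t * t ^ (-(3:ℝ)/2) * Real.exp (-c * t) * Real.exp (-b / t)
  have hW : Measurable W := by fun_prop
  have hW0 : ∀ t, 0 < t → 0 ≤ W t := fun t ht => by
    have := hf0 t
    positivity
  let K : ℝ → ℝ → ENNReal := fun x t => if t < x then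
    ENNReal.ofReal (W t) * ENNReal.ofReal ((x - t) / x ^ 4 * Real.exp (-(a - b) * x⁻¹)) else 0
  have hK : Measurable (Function.uncurry K) := by
    refine Measurable.ite (measurableSet_lt measurable_snd measurable_fst) ?_ measurable_const
    fun_prop
  have step1 : ∀ x ∈ Set.Ioi (0:ℝ), (∫⁻ y in Set.Ioi (0:ℝ),
        ENNReal.ofReal (x ^ (-(3:ℝ)/2) * y ^ (-(3:ℝ)/2) * (x + y) ^ (-(3:ℝ)/2) *
          f (x * y / (x + y)) *
          Real.exp (-a / x - b / y - c * (x * y / (x + y))))) =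
        ∫⁻ t in Set.Ioi (0:ℝ), K x t := by
    intro x hx
    have hx : 0 < x := hx
    rw [← aux_image x hx, lintegral_image_eq_lintegral_abs_deriv_mul measurableSet_Ioo
      (fun t ht => (aux_deriv x t ht.2).hasDerivWithinAt) (aux_inj x hx), aux_image x hx]
    have e : ∀ t, K x t = (Set.Iio x).indicator (fun t => ENNReal.ofReal (W t) *
        ENNReal.ofReal ((x - t) / x ^ 4 * Real.exp (-(a - b) * x⁻¹))) t := by
      intro t
      simp [K, Set.indicator]
    simp_rw [e]
    rw [lintegral_indicator measurableSet_Iio, Measure.restrict_restrict measurableSet_Iio,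
      Set.inter_comm, Set.Ioi_inter_Iio]
    refine setLIntegral_congr_fun measurableSet_Ioo ?_
    intro t ht
    have hp : 0 < x - t := sub_pos.2 ht.2
    have ht0 : 0 < t := ht.1
    have e1 : x * (x * t / (x - t)) / (x + x * t / (x - t)) = t := by
      have : x + x * t / (x - t) = x * x / (x - t) := by field_simp; ring
      rw [this]; field_simp
    have e2 : Real.exp (-a / x - b / (x * t / (x - t)) - c * t) =
        Real.exp (-c * t) * Real.exp (-b / t) * Real.exp (-(a - b) * x⁻¹) := by
      rw [← Real.exp_add, ← Real.exp_add]
      congr 1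
      field_simp
      ring
    simp only
    rw [abs_of_nonneg (by positivity), ← ENNReal.ofReal_mul (by positivity),
      ← ENNReal.ofReal_mul (hW0 t ht0), e1, e2]
    congr 1
    simp only [W]
    linear_combination (f t * (Real.exp (-c * t) * Real.exp (-b / t) *
      Real.exp (-(a - b) * x⁻¹))) * aux_rpow x t ht0 ht.2
  rw [setLIntegral_congr_fun measurableSet_Ioi step1,
    lintegral_lintegral_swap hK.aemeasurable, ← lintegral_const_mul _ (by fun_prop)]
  refine setLIntegral_congr_fun measurableSet_Ioi ?_
  intro t ht
  have ht0 : 0 < t := ht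
  have e : ∀ x, K x t = (Set.Ioi t).indicator (fun x => ENNReal.ofReal (W t) *
      ENNReal.ofReal ((x - t) / x ^ 4 * Real.exp (-(a - b) * x⁻¹))) x := by
    intro t
    simp [K, Set.indicator]
  simp_rw [e]
  rw [lintegral_indicator measurableSet_Ioi, Measure.restrict_restrict measurableSet_Ioi,
    Set.inter_eq_left.2 (Set.Ioi_subset_Ioi ht0.le), lintegral_const_mul _ (by fun_prop),
    aux_int _ _ hd ht0, ← ENNReal.ofReal_mul (hW0 t ht0), ← ENNReal.ofReal_mul (by positivity)]
  congr 1
  have e3 : (a - b) ^ (-(3:ℝ)) = ((a - b) ^ 3)⁻¹ := by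
    rw [Real.rpow_neg hd.le]
    norm_cast
  have e4 : Real.exp (-a / t) = Real.exp (-b / t) * Real.exp (-(a - b) / t) := by
    rw [← Real.exp_add]
    congr 1
    ring
  rw [e3, e4]
  simp only [W]
  ring
end
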